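/- Under Assumption A, let {(x_k, y_k)} and {(x̂_k, ŷ_k)} be sequences generated by Algorithm 1. Then the sequences {L(x_k, y_k)} and {L(x̂_k, ŷ_k)} are monotonically nonincreasing, satisfy for every k the inequalities L(x_{k+1}, y_{k+1}) ≤ L(x_k, y_k) − ρ‖(x_{k+1} − x̂_k, y_{k+1} − ŷ_k)‖² and L(x̂_{k+1}, ŷ_{k+1}) ≤ L(x̂_k, ŷ_k) − ρ‖(x_{k+1} − x̂_k, y_{k+1} − ŷ_k)‖² with ρ = min{(θ₁ − L_∇f)/2, (θ₂ − L_∇g)/2}, and both sequences converge to a common limit L*. -/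

import Mathlib

open Filter Topology
open scoped RealInnerProductSpace

/-- The Bregman distance `D_φ(x, y) = φ(x) − φ(y) − ⟨∇φ(y), x − y⟩`. -/
noncomputable def breg {d : ℕ} (φ : EuclideanSpace ℝ (Fin d) → ℝ)
    (x y : EuclideanSpace ℝ (Fin d)) : ℝ :=
  φ x - φ y - ⟪gradient φ y, x - y⟫

/-- The objective `L(x, y) = f(x) + Q(x, y) + g(y)`, extended-real valued. -/
noncomputable def LFun {n m : ℕ} (f : EuclideanSpace ℝ (Fin n) → ℝ)
    (g : EuclideanSpace ℝ (Fin m) → ℝ)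
    (Q : EuclideanSpace ℝ (Fin n) → EuclideanSpace ℝ (Fin m) → EReal)
    (x : EuclideanSpace ℝ (Fin n)) (y : EuclideanSpace ℝ (Fin m)) : EReal :=
  (f x : EReal) + Q x y + (g y : EReal)

/-- Assumption A of the paper. -/
structure AssumpA {n m : ℕ} (f : EuclideanSpace ℝ (Fin n) → ℝ)
    (g : EuclideanSpace ℝ (Fin m) → ℝ)
    (Q : EuclideanSpace ℝ (Fin n) → EuclideanSpace ℝ (Fin m) → EReal)
    (φ₁ : EuclideanSpace ℝ (Fin n) → ℝ) (φ₂ : EuclideanSpace ℝ (Fin m) → ℝ)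
    (Lf Lg θ₁ θ₂ η₁ η₂ : ℝ) : Prop where
  hLbd : ∃ B : ℝ, ∀ x y, (B : EReal) ≤ LFun f g Q x y
  hf : ContDiff ℝ 1 f
  hg : ContDiff ℝ 1 g
  hLf0 : 0 ≤ Lf
  hLg0 : 0 ≤ Lg
  hfLip : ∀ a b, ‖gradient f a - gradient f b‖ ≤ Lf * ‖a - b‖
  hgLip : ∀ a b, ‖gradient g a - gradient g b‖ ≤ Lg * ‖a - b‖
  hQproper : (∀ x y, Q x y ≠ ⊥) ∧ ∃ x y, Q x y ≠ ⊤
  hQlsc : LowerSemicontinuous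
    (fun p : EuclideanSpace ℝ (Fin n) × EuclideanSpace ℝ (Fin m) => Q p.1 p.2)
  hφ₁diff : Differentiable ℝ φ₁
  hφ₂diff : Differentiable ℝ φ₂
  hθ₁pos : 0 < θ₁
  hθ₂pos : 0 < θ₂
  hφ₁sc : ConvexOn ℝ Set.univ (fun u => φ₁ u - θ₁ / 2 * ‖u‖ ^ 2)
  hφ₂sc : ConvexOn ℝ Set.univ (fun u => φ₂ u - θ₂ / 2 * ‖u‖ ^ 2)
  hθ₁ : Lf < θ₁
  hθ₂ : Lg < θ₂
  hφ₁Lip : ∀ a b, ‖gradient φ₁ a - gradient φ₁ b‖ ≤ η₁ * ‖a - b‖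
  hφ₂Lip : ∀ a b, ‖gradient φ₂ a - gradient φ₂ b‖ ≤ η₂ * ‖a - b‖

/-- Algorithm 1 (TiBASAP) of the paper; `x k, y k` are the iterates and
`xh k, yh k` the (possibly extrapolated) auxiliary iterates.  The conventions
`x (-1) = x 0`, `y (-1) = y 0` are realized by truncated subtraction on `ℕ`. -/
structure Alg1 {n m : ℕ} (f : EuclideanSpace ℝ (Fin n) → ℝ)
    (g : EuclideanSpace ℝ (Fin m) → ℝ)
    (Q : EuclideanSpace ℝ (Fin n) → EuclideanSpace ℝ (Fin m) → EReal)
    (φ₁ : EuclideanSpace ℝ (Fin n) → ℝ) (φ₂ : EuclideanSpace ℝ (Fin m) → ℝ)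
    (αmax βmax : ℝ) (α β : ℕ → ℝ)
    (x xh : ℕ → EuclideanSpace ℝ (Fin n)) (y yh : ℕ → EuclideanSpace ℝ (Fin m)) :
    Prop where
  hαβmax : αmax + βmax < 1
  hα : ∀ k, α k ∈ Set.Icc (0 : ℝ) αmax
  hβ : ∀ k, β k ∈ Set.Icc (0 : ℝ) βmax
  hQ0 : Q (x 0) (y 0) ≠ ⊤
  hinit : xh 0 = x 0 ∧ yh 0 = y 0
  hxmin : ∀ k x',
    Q (x (k+1)) (yh k)
        + ((⟪gradient f (xh k), x (k+1)⟫ + breg φ₁ (x (k+1)) (xh k) : ℝ) : EReal)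
      ≤ Q x' (yh k) + ((⟪gradient f (xh k), x'⟫ + breg φ₁ x' (xh k) : ℝ) : EReal)
  hymin : ∀ k y',
    Q (x (k+1)) (y (k+1))
        + ((⟪gradient g (yh k), y (k+1)⟫ + breg φ₂ (y (k+1)) (yh k) : ℝ) : EReal)
      ≤ Q (x (k+1)) y' + ((⟪gradient g (yh k), y'⟫ + breg φ₂ y' (yh k) : ℝ) : EReal)
  hupdate : ∀ k u v,
    u = x (k+1) + α k • (x (k+1) - x k) + β k • (x k - x (k-1)) →
    v = y (k+1) + α k • (y (k+1) - y k) + β k • (y k - y (k-1)) →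
      (LFun f g Q u v ≤ LFun f g Q (x (k+1)) (y (k+1)) →
        xh (k+1) = u ∧ yh (k+1) = v) ∧
      (¬ LFun f g Q u v ≤ LFun f g Q (x (k+1)) (y (k+1)) →
        xh (k+1) = x (k+1) ∧ yh (k+1) = y (k+1))

section InnerProductSpace

variable {E : Type*} [NormedAddCommGroup E] [InnerProductSpace ℝ E] [CompleteSpace E]

/-- The derivative of a function along a line, in terms of its gradient. -/
theorem hasDerivAt_comp_line {f : E → ℝ} (hf : Differentiable ℝ f) (a v : E) (t : ℝ) :
    HasDerivAt (fun s : ℝ => f (a + s • v)) ⟪gradient f (a + t • v), v⟫ t := by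
  have hline : HasDerivAt (fun s : ℝ => a + s • v) v t := by
    simpa using ((hasDerivAt_id t).smul_const v).const_add a
  simpa [Function.comp_def] using
    (hf (a + t • v)).hasGradientAt.hasFDerivAt.comp_hasDerivAt t hline

/-- The descent lemma for functions with Lipschitz gradient. -/
theorem le_add_inner_gradient_add_sq {f : E → ℝ} {L : ℝ} (hf : Differentiable ℝ f)
    (hLip : ∀ a b, ‖gradient f a - gradient f b‖ ≤ L * ‖a - b‖) (a b : E) :
    f b ≤ f a + ⟪gradient f a, b - a⟫ + L / 2 * ‖b - a‖ ^ 2 := by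
  set v := b - a with hv
  let h : ℝ → ℝ := fun t => f (a + t • v) - (t * ⟪gradient f a, v⟫ + t ^ 2 * (L / 2 * ‖v‖ ^ 2))
  have hderiv (t : ℝ) : HasDerivAt h (⟪gradient f (a + t • v), v⟫ -
      (⟪gradient f a, v⟫ + 2 * t * (L / 2 * ‖v‖ ^ 2))) t := by
    refine (hasDerivAt_comp_line hf a v t).sub (.add ?_ ?_)
    · simpa using (hasDerivAt_id t).mul_const ⟪gradient f a, v⟫
    · simpa using (hasDerivAt_pow 2 t).mul_const (L / 2 * ‖v‖ ^ 2)
  have hanti : AntitoneOn h (Set.Icc 0 1) := by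
    refine antitoneOn_of_hasDerivWithinAt_nonpos (convex_Icc 0 1)
      (fun t _ => (hderiv t).continuousAt.continuousWithinAt)
      (fun t _ => (hderiv t).hasDerivWithinAt) fun t ht => ?_
    rw [interior_Icc] at ht
    have hgrad : ‖gradient f (a + t • v) - gradient f a‖ ≤ L * (t * ‖v‖) := by
      simpa [norm_smul, abs_of_pos ht.1] using hLip (a + t • v) a
    have hinner := real_inner_le_norm (gradient f (a + t • v) - gradient f a) v
    rw [inner_sub_left] at hinner
    nlinarith [mul_le_mul_of_nonneg_right hgrad (norm_nonneg v)]
  have h01 := hanti (Set.left_mem_Icc.2 zero_le_one) (Set.right_mem_Icc.2 zero_le_one) zero_le_one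
  simp only [h, hv, one_smul, zero_smul, add_zero, add_sub_cancel] at h01
  rw [hv]
  linarith

/-- The first-order lower bound for strongly convex functions. -/
theorem add_inner_gradient_add_sq_le {φ : E → ℝ} {θ : ℝ} (hφ : Differentiable ℝ φ)
    (hconv : ConvexOn ℝ Set.univ (fun u => φ u - θ / 2 * ‖u‖ ^ 2)) (a b : E) :
    φ a + ⟪gradient φ a, b - a⟫ + θ / 2 * ‖b - a‖ ^ 2 ≤ φ b := by
  obtain ⟨v, rfl⟩ : ∃ v, b = a + v := ⟨b - a, by simp⟩
  have hsq (t : ℝ) : ‖a + t • v‖ ^ 2 = ‖a‖ ^ 2 + t * (2 * ⟪a, v⟫) + t ^ 2 * ‖v‖ ^ 2 := by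
    rw [norm_add_sq_real, inner_smul_right, norm_smul, mul_pow, Real.norm_eq_abs, sq_abs]
    ring
  let h : ℝ → ℝ := fun t => φ (a + t • v) - θ / 2 * ‖a + t • v‖ ^ 2
  have hh : ConvexOn ℝ Set.univ h := by
    have := hconv.comp_affineMap (AffineMap.lineMap a (a + v))
    simpa [h, Function.comp_def, AffineMap.lineMap_apply, add_comm] using this
  have hderiv : HasDerivAt h (⟪gradient φ a, v⟫ - θ / 2 * (2 * ⟪a, v⟫)) 0 := by
    refine HasDerivAt.sub (by simpa using hasDerivAt_comp_line hφ a v 0) (.const_mul _ ?_)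
    simp only [hsq]
    have hlin := (hasDerivAt_id (0 : ℝ)).mul_const (2 * ⟪a, v⟫)
    have hquad := (hasDerivAt_pow 2 (0 : ℝ)).mul_const (‖v‖ ^ 2)
    refine ((hlin.const_add (‖a‖ ^ 2)).add hquad).congr_deriv ?_
    simp
  have hslope := hh.le_slope_of_hasDerivAt (Set.mem_univ 0) (Set.mem_univ 1) zero_lt_one hderiv
  have hsq1 := hsq 1
  simp only [one_smul] at hsq1
  simp only [slope_def_field, h, one_smul, zero_smul, add_zero, hsq1, sub_zero, div_one] at hslope
  rw [add_sub_cancel_left]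
  linarith

end InnerProductSpace

/-- Sufficient decrease for a single linearized Bregman proximal step. Here `q` and `q'` are the
values of the nonsmooth part at the new point `b` and at the base point `a`. -/
theorem bregman_step_decrease {d : ℕ} {f φ : EuclideanSpace ℝ (Fin d) → ℝ} {L θ : ℝ}
    (hf : Differentiable ℝ f)
    (hLip : ∀ a b, ‖gradient f a - gradient f b‖ ≤ L * ‖a - b‖)
    (hφ : Differentiable ℝ φ)
    (hconv : ConvexOn ℝ Set.univ (fun u => φ u - θ / 2 * ‖u‖ ^ 2))
    {a b : EuclideanSpace ℝ (Fin d)} {q q' : EReal}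
    (hmin : q + ((⟪gradient f a, b⟫ + breg φ b a : ℝ) : EReal)
      ≤ q' + ((⟪gradient f a, a⟫ + breg φ a a : ℝ) : EReal)) :
    q + ((f b + (θ - L) / 2 * ‖b - a‖ ^ 2 : ℝ) : EReal) ≤ q' + (f a : EReal) := by
  have hdesc := le_add_inner_gradient_add_sq hf hLip a b
  have hstrong := add_inner_gradient_add_sq_le hφ hconv a b
  have hreal : f b + (θ - L) / 2 * ‖b - a‖ ^ 2 ≤
      (⟪gradient f a, b⟫ + breg φ b a) + (f a - ⟪gradient f a, a⟫) := by
    rw [inner_sub_right] at hdesc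
    simp only [breg]
    linarith
  calc q + ((f b + (θ - L) / 2 * ‖b - a‖ ^ 2 : ℝ) : EReal)
      ≤ q + (((⟪gradient f a, b⟫ + breg φ b a) + (f a - ⟪gradient f a, a⟫) : ℝ) : EReal) := by
        gcongr
    _ = q + ((⟪gradient f a, b⟫ + breg φ b a : ℝ) : EReal)
          + ((f a - ⟪gradient f a, a⟫ : ℝ) : EReal) := by rw [EReal.coe_add, add_assoc]
    _ ≤ q' + ((⟪gradient f a, a⟫ + breg φ a a : ℝ) : EReal)
          + ((f a - ⟪gradient f a, a⟫ : ℝ) : EReal) := by gcongr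
    _ = q' + (f a : EReal) := by
        rw [add_assoc, ← EReal.coe_add]
        simp [breg]

/-- Combination of the decrease estimates of two successive block updates. -/
theorem EReal.add_add_le_sub_of_block_le {p q r : EReal} {a a' b b' c e s : ℝ}
    (hs : s ≤ c + e) (h₁ : q + ((a' + c : ℝ) : EReal) ≤ p + (a : EReal))
    (h₂ : r + ((b' + e : ℝ) : EReal) ≤ q + (b : EReal)) :
    (a' : EReal) + r + (b' : EReal) ≤ (a : EReal) + p + (b : EReal) - (s : EReal) := by
  have hsplit : (a' : EReal) + r + (b' : EReal) =
      r + ((b' + e : ℝ) : EReal) + ((a' - e : ℝ) : EReal) := by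
    rw [add_comm (a' : EReal) r, add_assoc, add_assoc, ← EReal.coe_add, ← EReal.coe_add]
    congr 2
    ring
  have hmid : q + (b : EReal) + ((a' - e : ℝ) : EReal) =
      q + ((a' + c : ℝ) : EReal) + ((b - c - e : ℝ) : EReal) := by
    rw [add_assoc, add_assoc, ← EReal.coe_add, ← EReal.coe_add]
    congr 2
    ring
  have hend : (a : EReal) + p + (b : EReal) - (s : EReal) =
      p + (a : EReal) + ((b - s : ℝ) : EReal) := by
    rw [add_comm (a : EReal) p, sub_eq_add_neg, ← EReal.coe_neg, add_assoc, ← EReal.coe_add,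
      ← sub_eq_add_neg]
  rw [hsplit, hend]
  calc _ ≤ q + (b : EReal) + ((a' - e : ℝ) : EReal) := by gcongr
    _ = q + ((a' + c : ℝ) : EReal) + ((b - c - e : ℝ) : EReal) := hmid
    _ ≤ p + (a : EReal) + ((b - s : ℝ) : EReal) := by
      refine add_le_add h₁ ?_
      exact_mod_cast (by linarith : b - c - e ≤ b - s)

/-- Subtracting a nonnegative real number does not increase an extended real. -/
theorem EReal.sub_coe_le_self {p : EReal} {s : ℝ} (hs : 0 ≤ s) : p - (s : EReal) ≤ p := by
  simpa using EReal.sub_le_sub (le_refl p) (EReal.coe_nonneg.2 hs)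

/-- monotone decrease of the objective values along Algorithm 1
and convergence of both value sequences to a common limit. -/
theorem alg1_monotone_decrease {n m : ℕ}
    (f : EuclideanSpace ℝ (Fin n) → ℝ) (g : EuclideanSpace ℝ (Fin m) → ℝ)
    (Q : EuclideanSpace ℝ (Fin n) → EuclideanSpace ℝ (Fin m) → EReal)
    (φ₁ : EuclideanSpace ℝ (Fin n) → ℝ) (φ₂ : EuclideanSpace ℝ (Fin m) → ℝ)
    (Lf Lg θ₁ θ₂ η₁ η₂ αmax βmax : ℝ) (α β : ℕ → ℝ)
    (x xh : ℕ → EuclideanSpace ℝ (Fin n)) (y yh : ℕ → EuclideanSpace ℝ (Fin m))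
    (hA : AssumpA f g Q φ₁ φ₂ Lf Lg θ₁ θ₂ η₁ η₂)
    (halg : Alg1 f g Q φ₁ φ₂ αmax βmax α β x xh y yh) :
    Antitone (fun k => LFun f g Q (x k) (y k)) ∧
    Antitone (fun k => LFun f g Q (xh k) (yh k)) ∧
    (∀ k, LFun f g Q (x (k+1)) (y (k+1))
        ≤ LFun f g Q (x k) (y k)
          - ((min ((θ₁ - Lf) / 2) ((θ₂ - Lg) / 2)
              * (‖x (k+1) - xh k‖ ^ 2 + ‖y (k+1) - yh k‖ ^ 2) : ℝ) : EReal)) ∧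
    (∀ k, LFun f g Q (xh (k+1)) (yh (k+1))
        ≤ LFun f g Q (xh k) (yh k)
          - ((min ((θ₁ - Lf) / 2) ((θ₂ - Lg) / 2)
              * (‖x (k+1) - xh k‖ ^ 2 + ‖y (k+1) - yh k‖ ^ 2) : ℝ) : EReal)) ∧
    ∃ Lstar : EReal,
      Tendsto (fun k => LFun f g Q (x k) (y k)) atTop (𝓝 Lstar) ∧
      Tendsto (fun k => LFun f g Q (xh k) (yh k)) atTop (𝓝 Lstar) := by
  set ρ := min ((θ₁ - Lf) / 2) ((θ₂ - Lg) / 2)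
  have hρ0 : 0 ≤ ρ := le_min (by linarith [hA.hθ₁]) (by linarith [hA.hθ₂])
  have hgap (k : ℕ) : 0 ≤ ρ * (‖x (k+1) - xh k‖ ^ 2 + ‖y (k+1) - yh k‖ ^ 2) := by positivity
  have hstep (k : ℕ) : LFun f g Q (x (k+1)) (y (k+1)) ≤ LFun f g Q (xh k) (yh k)
      - ((ρ * (‖x (k+1) - xh k‖ ^ 2 + ‖y (k+1) - yh k‖ ^ 2) : ℝ) : EReal) := by
    refine EReal.add_add_le_sub_of_block_le ?_
      (bregman_step_decrease (hA.hf.differentiable one_ne_zero) hA.hfLip hA.hφ₁diff hA.hφ₁sc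
        (halg.hxmin k (xh k)))
      (bregman_step_decrease (hA.hg.differentiable one_ne_zero) hA.hgLip hA.hφ₂diff hA.hφ₂sc
        (halg.hymin k (yh k)))
    rw [mul_add]
    gcongr
    · exact min_le_left _ _
    · exact min_le_right _ _
  have hupd (k : ℕ) : LFun f g Q (xh k) (yh k) ≤ LFun f g Q (x k) (y k) := by
    cases k with
    | zero => rw [halg.hinit.1, halg.hinit.2]
    | succ k =>
      obtain ⟨haccept, hreject⟩ := halg.hupdate k _ _ rfl rfl
      by_cases hle : LFun f g Q (x (k+1) + α k • (x (k+1) - x k) + β k • (x k - x (k-1)))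
          (y (k+1) + α k • (y (k+1) - y k) + β k • (y k - y (k-1)))
            ≤ LFun f g Q (x (k+1)) (y (k+1))
      · rwa [(haccept hle).1, (haccept hle).2]
      · rw [(hreject hle).1, (hreject hle).2]
  have hdecx (k : ℕ) := (hstep k).trans (EReal.sub_le_sub (hupd k) le_rfl)
  have hdecxh (k : ℕ) := (hupd (k+1)).trans (hstep k)
  have hantix : Antitone (fun k => LFun f g Q (x k) (y k)) :=
    antitone_nat_of_succ_le fun k => (hdecx k).trans (EReal.sub_coe_le_self (hgap k))
  have hantixh : Antitone (fun k => LFun f g Q (xh k) (yh k)) :=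
    antitone_nat_of_succ_le fun k => (hdecxh k).trans (EReal.sub_coe_le_self (hgap k))
  have hlim := tendsto_atTop_iInf hantixh
  refine ⟨hantix, hantixh, hdecx, hdecxh, _, ?_, hlim⟩
  rw [← tendsto_add_atTop_iff_nat 1]
  exact tendsto_of_tendsto_of_tendsto_of_le_of_le ((tendsto_add_atTop_iff_nat 1).2 hlim) hlim
    (fun k => hupd (k+1)) (fun k => (hstep k).trans (EReal.sub_coe_le_self (hgap k)))
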